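/- arXiv:2406.16406 — 2 statements merged into one kernel-verified Lean document; each statement's English description precedes it below -/
import Mathlib

section
/- A right-infinite sequence α over a finite alphabet is ultimately periodic if and only if there exists a positive integer n with P_α(n) ≤ n, if and only if the function P_α is bounded. -/
open Filter Asymptotics

variable {A : Type*}

/-- Extension of a morphism, given on letters, to words. -/
def wordMap (φ : A → List A) (w : List A) : List A := w.flatMap φ

/-- The factor of the infinite word α of length n starting at position i. -/
def factorAt (α : ℕ → A) (i n : ℕ) : List A := (List.range n).map (fun j => α (i + j))

/-- w is a factor (contiguous subword) of the infinite word α. -/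
def IsFactor (α : ℕ → A) (w : List A) : Prop := ∃ i, w = factorAt α i w.length

/-- The factor complexity of α: the number of distinct factors of length n. -/
noncomputable def complexity (α : ℕ → A) (n : ℕ) : ℕ :=
  Set.ncard {w : List A | w.length = n ∧ IsFactor α w}

def UltimatelyPeriodic (α : ℕ → A) : Prop :=
  ∃ N p : ℕ, 1 ≤ p ∧ ∀ i, N ≤ i → α (i + p) = α i

/-- φ is prolongable on a: φ(a) = a·w with w nonempty and |φ^n(a)| → ∞. -/
def Prolongable (φ : A → List A) (a : A) : Prop :=
  (∃ w, w ≠ [] ∧ φ a = a :: w) ∧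
    Tendsto (fun n => ((wordMap φ)^[n] [a]).length) atTop atTop

/-- α is the pure morphic sequence φ^∞(a): every iterate φ^n(a) is a prefix of α. -/
def IsFixedSeq (φ : A → List A) (a : A) (α : ℕ → A) : Prop :=
  ∀ n, factorAt α 0 ((wordMap φ)^[n] [a]).length = (wordMap φ)^[n] [a]

/-- The letter b is growing for φ: |φ^k(b)| → ∞. -/
def GrowingLetter (φ : A → List A) (b : A) : Prop :=
  Tendsto (fun k => ((wordMap φ)^[k] [b]).length) atTop atTop

def BoundedLetter (φ : A → List A) (b : A) : Prop := ¬ GrowingLetter φ b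

/-- φ is growing: every letter is growing. -/
def Growing (φ : A → List A) : Prop := ∀ b, GrowingLetter φ b

theorem factorAt_eq_iff {α : ℕ → A} {i j n : ℕ} :
    factorAt α i n = factorAt α j n ↔ ∀ k < n, α (i + k) = α (j + k) := by
  simp [factorAt, List.map_inj_left]

theorem complexity_eq_ncard_range (α : ℕ → A) (n : ℕ) :
    complexity α n = (Set.range fun i => factorAt α i n).ncard := by
  unfold complexity
  congr 1
  ext w
  constructor
  · rintro ⟨rfl, i, hi⟩
    exact ⟨i, hi.symm⟩
  · rintro ⟨i, rfl⟩
    have hlen : (factorAt α i n).length = n := by simp [factorAt]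
    exact ⟨hlen, i, by rw [hlen]⟩

theorem finite_range_factorAt [Finite A] (α : ℕ → A) (n : ℕ) :
    (Set.range fun i => factorAt α i n).Finite := by
  refine (List.finite_length_eq A n).subset ?_
  rintro _ ⟨i, rfl⟩
  simp [factorAt]

theorem complexity_zero (α : ℕ → A) : complexity α 0 = 1 := by
  simp [complexity_eq_ncard_range, factorAt]

/-- An ultimately periodic word has at most preperiod plus period many factors of each length. -/
theorem complexity_le_of_eventually_periodic {α : ℕ → A} {N p : ℕ} (hp : 1 ≤ p)
    (h : ∀ i, N ≤ i → α (i + p) = α i) (n : ℕ) : complexity α n ≤ N + p := by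
  have hsub : (Set.range fun i => factorAt α i n) ⊆
      (fun i => factorAt α i n) '' (Finset.range (N + p) : Set ℕ) := by
    rintro _ ⟨i, rfl⟩
    induction i using Nat.strong_induction_on with
    | _ i ih =>
      by_cases hi : i < N + p
      · exact ⟨i, by simpa using hi, rfl⟩
      · have heq : factorAt α (i - p) n = factorAt α i n := by
          rw [factorAt_eq_iff]
          intro k _
          rw [← h (i - p + k) (by omega)]
          congr 1
          omega
        simpa only [heq] using ih (i - p) (by omega)
  rw [complexity_eq_ncard_range]
  calc _ ≤ _ := Set.ncard_le_ncard hsub ((Finset.finite_toSet _).image _)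
    _ ≤ (Finset.range (N + p) : Set ℕ).ncard := Set.ncard_image_le (Finset.finite_toSet _)
    _ = N + p := by rw [Set.ncard_coe_finset, Finset.card_range]

/-- If the complexity does not grow from `m` to `m + 1`, each factor of length `m` determines
the letter that follows it. -/
theorem next_letter_eq_of_complexity_succ_le [Finite A] {α : ℕ → A} {m : ℕ}
    (hm : complexity α (m + 1) ≤ complexity α m) {i j : ℕ}
    (hij : factorAt α i m = factorAt α j m) : α (i + m) = α (j + m) := by
  have htake (i : ℕ) : (factorAt α i (m + 1)).take m = factorAt α i m := by
    simp [factorAt, ← List.map_take, List.take_range]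
  have himage : List.take m '' (Set.range fun i => factorAt α i (m + 1)) =
      Set.range fun i => factorAt α i m := by
    rw [← Set.range_comp]
    exact congrArg Set.range (funext htake)
  have hfin := finite_range_factorAt α (m + 1)
  have hinj : Set.InjOn (List.take m) (Set.range fun i => factorAt α i (m + 1)) := by
    refine Set.injOn_of_ncard_image_eq (le_antisymm (Set.ncard_image_le hfin) ?_) hfin
    rwa [himage, ← complexity_eq_ncard_range, ← complexity_eq_ncard_range]
  have heq : factorAt α i (m + 1) = factorAt α j (m + 1) :=
    hinj ⟨i, rfl⟩ ⟨j, rfl⟩ (by rw [htake, htake, hij])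
  exact factorAt_eq_iff.1 heq m (Nat.lt_succ_self m)

theorem ultimatelyPeriodic_of_complexity_succ_le [Finite A] {α : ℕ → A} {m : ℕ}
    (hm : complexity α (m + 1) ≤ complexity α m) : UltimatelyPeriodic α := by
  obtain ⟨i, j, hlt, hij⟩ : ∃ i j, i < j ∧ factorAt α i m = factorAt α j m := by
    have := (finite_range_factorAt α m).to_subtype
    obtain ⟨i, j, hne, hij⟩ :=
      Finite.exists_ne_map_eq_of_infinite (Set.rangeFactorization fun i => factorAt α i m)
    have hij : factorAt α i m = factorAt α j m := congrArg Subtype.val hij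
    rcases hne.lt_or_gt with hlt | hlt
    · exact ⟨i, j, hlt, hij⟩
    · exact ⟨j, i, hlt, hij.symm⟩
  have hshift (k : ℕ) : α (i + k) = α (j + k) := by
    induction k using Nat.strong_induction_on with
    | _ k ih =>
      by_cases hk : k < m
      · exact factorAt_eq_iff.1 hij k hk
      · obtain ⟨d, rfl⟩ := Nat.exists_eq_add_of_le' (not_lt.1 hk)
        rw [← add_assoc, ← add_assoc]
        refine next_letter_eq_of_complexity_succ_le hm (factorAt_eq_iff.2 fun l hl => ?_)
        rw [add_assoc, add_assoc]
        exact ih (d + l) (by omega)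
  refine ⟨i, j - i, by omega, fun n hn => ?_⟩
  have hn' := hshift (n - i)
  rw [show i + (n - i) = n by omega, show j + (n - i) = n + (j - i) by omega] at hn'
  exact hn'.symm

theorem ultimatelyPeriodic_of_complexity_le [Finite A] {α : ℕ → A} {n : ℕ}
    (hn : complexity α n ≤ n) : UltimatelyPeriodic α := by
  by_contra hper
  have hgrow (m : ℕ) : m + 1 ≤ complexity α m := by
    induction m with
    | zero => rw [complexity_zero]
    | succ m ih =>
      have hlt : complexity α m < complexity α (m + 1) :=
        not_le.1 fun h => hper (ultimatelyPeriodic_of_complexity_succ_le h)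
      omega
  have := hgrow n
  omega

/-- Morse–Hedlund theorem. -/
theorem morse_hedlund {A : Type*} [Fintype A] (α : ℕ → A) :
    (UltimatelyPeriodic α ↔ ∃ n : ℕ, 0 < n ∧ complexity α n ≤ n) ∧
    (UltimatelyPeriodic α ↔ ∃ C : ℕ, ∀ n, complexity α n ≤ C) := by
  have hbounded : UltimatelyPeriodic α → ∃ C : ℕ, ∀ n, complexity α n ≤ C :=
    fun ⟨N, p, hp, h⟩ => ⟨N + p, complexity_le_of_eventually_periodic hp h⟩
  refine ⟨⟨fun h => ?_, fun ⟨_, _, hn⟩ => ultimatelyPeriodic_of_complexity_le hn⟩,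
    hbounded, fun ⟨C, hC⟩ => ultimatelyPeriodic_of_complexity_le (hC C)⟩
  obtain ⟨C, hC⟩ := hbounded h
  exact ⟨C + 1, C.succ_pos, (hC _).trans C.le_succ⟩
end

section
/- For every morphism φ : A* → A* on a finite alphabet A and every letter a ∈ A, there exists a pair (β, α) with β a real number ≥ 1 and α a natural number, or (β, α) = (0, 0), such that |φ^k(a)| = Θ(k^α · β^k) as k → ∞. -/
open Filter Asymptotics

variable {A : Type*}

/-- A sequence is eventually zero, or is comparable to `(n + 1) ^ e * β ^ n` with `1 ≤ β`. -/
def HasPolyExpGrowth (f : ℕ → ℝ) : Prop :=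
  (∀ n, 0 ≤ f n) ∧
    ((∃ N, ∀ n, N ≤ n → f n = 0) ∨
      ∃ (β : ℝ) (e : ℕ) (c K : ℝ), 1 ≤ β ∧ 0 < c ∧ 0 < K ∧
        ∀ n : ℕ, c * (((n : ℝ) + 1) ^ e * β ^ n) ≤ f n ∧ f n ≤ K * (((n : ℝ) + 1) ^ e * β ^ n))

theorem summable_succ_pow_mul_geometric (e : ℕ) {r : ℝ} (h0 : 0 < r) (h1 : r < 1) :
    Summable fun n : ℕ => ((n : ℝ) + 1) ^ e * r ^ n := by
  have h := summable_pow_mul_geometric_of_norm_lt_one (R := ℝ) e (r := r)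
    (by rwa [Real.norm_of_nonneg h0.le])
  have h2 := ((summable_nat_add_iff 1).2 h).mul_left r⁻¹
  refine h2.congr fun n => ?_
  push_cast
  rw [pow_succ]
  field_simp

theorem exists_polyExp_le_of_lt {β γ : ℝ} (hβ : 1 ≤ β) (h : β < γ) (d e : ℕ) :
    ∃ K : ℝ, 0 < K ∧
      ∀ n : ℕ, ((n : ℝ) + 1) ^ d * β ^ n ≤ K * (((n : ℝ) + 1) ^ e * γ ^ n) := by
  have hγ : 0 < γ := by linarith
  have hr : 0 < β / γ := by positivity
  have hs := summable_succ_pow_mul_geometric d hr ((div_lt_one hγ).2 h)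
  have hp : ∀ n : ℕ, 0 ≤ ((n : ℝ) + 1) ^ d * (β / γ) ^ n := fun n => by positivity
  refine ⟨(∑' n : ℕ, ((n : ℝ) + 1) ^ d * (β / γ) ^ n) + 1, ?_, fun n => ?_⟩
  · have : 0 ≤ ∑' n : ℕ, ((n : ℝ) + 1) ^ d * (β / γ) ^ n := tsum_nonneg hp
    linarith
  · have h1 := hs.le_tsum n fun j _ => hp j
    have h2 : (1 : ℝ) ≤ ((n : ℝ) + 1) ^ e := one_le_pow₀ (by linarith [n.cast_nonneg (α := ℝ)])
    have h3 : ((n : ℝ) + 1) ^ d * β ^ n = (((n : ℝ) + 1) ^ d * (β / γ) ^ n) * γ ^ n := by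
      rw [div_pow]; field_simp
    rw [h3]
    have h4 : γ ^ n ≤ ((n : ℝ) + 1) ^ e * γ ^ n := le_mul_of_one_le_left (by positivity) h2
    have := hp n
    exact mul_le_mul (by linarith) h4 (by positivity) (by linarith)

theorem exists_polyExp_le_total {β γ : ℝ} (hβ : 1 ≤ β) (hγ : 1 ≤ γ) (d e : ℕ) :
    (∃ K : ℝ, 0 < K ∧
      ∀ n : ℕ, ((n : ℝ) + 1) ^ d * β ^ n ≤ K * (((n : ℝ) + 1) ^ e * γ ^ n)) ∨
    (∃ K : ℝ, 0 < K ∧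
      ∀ n : ℕ, ((n : ℝ) + 1) ^ e * γ ^ n ≤ K * (((n : ℝ) + 1) ^ d * β ^ n)) := by
  have key : ∀ (n : ℕ) {d e : ℕ}, d ≤ e →
      ((n : ℝ) + 1) ^ d * β ^ n ≤ 1 * (((n : ℝ) + 1) ^ e * β ^ n) := fun n d e hde => by
    rw [one_mul]
    exact mul_le_mul_of_nonneg_right
      (pow_le_pow_right₀ (by linarith [n.cast_nonneg (α := ℝ)]) hde) (by positivity)
  rcases lt_trichotomy β γ with h | rfl | h
  · exact Or.inl (exists_polyExp_le_of_lt hβ h d e)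
  · rcases le_total d e with h | h
    · exact Or.inl ⟨1, one_pos, fun n => key n h⟩
    · exact Or.inr ⟨1, one_pos, fun n => key n h⟩
  · exact Or.inr (exists_polyExp_le_of_lt hγ h e d)

namespace HasPolyExpGrowth

theorem zero : HasPolyExpGrowth fun _ => 0 :=
  ⟨fun _ => le_rfl, Or.inl ⟨0, fun _ _ => rfl⟩⟩

theorem of_comparable {f g : ℕ → ℝ} (hf : HasPolyExpGrowth f) {c K : ℝ} (hc : 0 < c)
    (hK : 0 < K) (h1 : ∀ n, c * f n ≤ g n) (h2 : ∀ n, g n ≤ K * f n) : HasPolyExpGrowth g := by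
  obtain ⟨h0, h⟩ := hf
  have hg : ∀ n, 0 ≤ g n := fun n => (mul_nonneg hc.le (h0 n)).trans (h1 n)
  refine ⟨hg, ?_⟩
  rcases h with ⟨N, hN⟩ | ⟨β, e, c', K', hβ, hc', hK', h⟩
  · refine Or.inl ⟨N, fun n hn => le_antisymm ?_ (hg n)⟩
    simpa [hN n hn] using h2 n
  · refine Or.inr ⟨β, e, c * c', K * K', hβ, by positivity, by positivity, fun n => ⟨?_, ?_⟩⟩
    · rw [mul_assoc]
      exact (mul_le_mul_of_nonneg_left (h n).1 hc.le).trans (h1 n)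
    · rw [mul_assoc]
      exact (h2 n).trans (mul_le_mul_of_nonneg_left (h n).2 hK.le)

theorem const_mul {f : ℕ → ℝ} (hf : HasPolyExpGrowth f) {c : ℝ} (hc : 0 < c) :
    HasPolyExpGrowth fun n => c * f n :=
  hf.of_comparable hc hc (fun _ => le_rfl) fun _ => le_rfl

theorem le_sum_range_of_eventually_zero {f : ℕ → ℝ} (h0 : ∀ n, 0 ≤ f n) {N : ℕ}
    (hN : ∀ n, N ≤ n → f n = 0) (n : ℕ) : f n ≤ ∑ j ∈ Finset.range N, f j := by
  rcases lt_or_ge n N with h | h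
  · exact Finset.single_le_sum (f := f) (fun j _ => h0 j) (Finset.mem_range.2 h)
  · rw [hN n h]
    exact Finset.sum_nonneg fun j _ => h0 j

theorem add_of_le {f g : ℕ → ℝ} (hf : ∀ n, 0 ≤ f n) (hg : HasPolyExpGrowth g) {K : ℝ}
    (hK : 0 < K) (h : ∀ n, f n ≤ K * g n) : HasPolyExpGrowth fun n => f n + g n :=
  hg.of_comparable one_pos (K := K + 1) (by linarith) (fun n => by linarith [hf n])
    fun n => by linarith [h n]

theorem add_of_eventually_zero {f g : ℕ → ℝ} (hf : ∀ n, 0 ≤ f n) {N : ℕ}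
    (hN : ∀ n, N ≤ n → f n = 0) (hg : HasPolyExpGrowth g) :
    HasPolyExpGrowth fun n => f n + g n := by
  rcases hg.2 with ⟨N', hN'⟩ | ⟨β, e, c, K, hβ, hc, hK, h⟩
  · exact ⟨fun n => add_nonneg (hf n) (hg.1 n), Or.inl ⟨max N N', fun n hn => by
      simp [hN n (le_trans (le_max_left _ _) hn), hN' n (le_trans (le_max_right _ _) hn)]⟩⟩
  · have hS : 0 ≤ ∑ j ∈ Finset.range N, f j := Finset.sum_nonneg fun j _ => hf j
    refine add_of_le hf hg (K := (∑ j ∈ Finset.range N, f j + 1) / c) (by positivity) fun n => ?_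
    have h1 := le_sum_range_of_eventually_zero hf hN n
    have h2 : (1 : ℝ) ≤ ((n : ℝ) + 1) ^ e * β ^ n :=
      one_le_mul_of_one_le_of_one_le (one_le_pow₀ (by linarith [n.cast_nonneg (α := ℝ)]))
        (one_le_pow₀ hβ)
    have h3 : c ≤ g n := le_trans (by nlinarith) (h n).1
    rw [div_mul_eq_mul_div, le_div_iff₀ hc]
    exact mul_le_mul (by linarith) h3 hc.le (by linarith)

theorem add {f g : ℕ → ℝ} (hf : HasPolyExpGrowth f) (hg : HasPolyExpGrowth g) :
    HasPolyExpGrowth fun n => f n + g n := by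
  rcases hf.2 with ⟨N, hN⟩ | ⟨β, d, c, K, hβ, hc, hK, h⟩
  · exact add_of_eventually_zero hf.1 hN hg
  rcases hg.2 with ⟨N, hN⟩ | ⟨γ, e, c', K', hγ, hc', hK', h'⟩
  · simpa only [add_comm] using add_of_eventually_zero hg.1 hN hf
  have key : ∀ {f g p q : ℕ → ℝ} {K L c : ℝ}, 0 < K → 0 < c → 0 < L → (∀ n, f n ≤ K * p n) →
      (∀ n, p n ≤ L * q n) → (∀ n, c * q n ≤ g n) → ∀ n, f n ≤ K * L / c * g n := by
    intro f g p q K L c hK hc hL h1 h2 h3 n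
    calc f n ≤ K * (L * q n) := (h1 n).trans (mul_le_mul_of_nonneg_left (h2 n) hK.le)
      _ = K * L / c * (c * q n) := by field_simp
      _ ≤ K * L / c * g n := mul_le_mul_of_nonneg_left (h3 n) (by positivity)
  rcases exists_polyExp_le_total hβ hγ d e with ⟨L, hL, hle⟩ | ⟨L, hL, hle⟩
  · exact add_of_le hf.1 hg (by positivity)
      (key hK hc' hL (fun n => (h n).2) hle fun n => (h' n).1)
  · simpa only [add_comm] using add_of_le hg.1 hf (by positivity)
      (key hK' hc hL (fun n => (h' n).2) hle fun n => (h n).1)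

theorem sum {ι : Type*} (s : Finset ι) {f : ι → ℕ → ℝ} (h : ∀ i ∈ s, HasPolyExpGrowth (f i)) :
    HasPolyExpGrowth fun n => ∑ i ∈ s, f i n := by
  classical
  induction s using Finset.induction_on with
  | empty => simpa using zero
  | insert i s hi ih =>
    simp only [Finset.sum_insert hi]
    exact (h i (Finset.mem_insert_self i s)).add
      (ih fun j hj => h j (Finset.mem_insert_of_mem hj))

theorem of_succ {f : ℕ → ℝ} (h0 : 0 < f 0) (h : HasPolyExpGrowth fun n => f (n + 1)) :
    HasPolyExpGrowth f := by
  refine ⟨fun n => by cases n with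
    | zero => exact h0.le
    | succ n => exact h.1 n, ?_⟩
  rcases h.2 with ⟨N, hN⟩ | ⟨β, e, c, K, hβ, hc, hK, h⟩
  · exact Or.inl ⟨N + 1, fun n hn => by
      obtain ⟨m, rfl⟩ : ∃ m, n = m + 1 := ⟨n - 1, by omega⟩
      exact hN m (by omega)⟩
  · have hβ0 : 0 < β := by linarith
    refine Or.inr ⟨β, e, min (f 0) (c / (2 ^ e * β)), max (f 0) K, hβ,
      lt_min h0 (by positivity), lt_max_of_lt_left h0, fun n => ?_⟩
    cases n with
    | zero => simp
    | succ n =>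
      have hn : (0 : ℝ) ≤ n := n.cast_nonneg
      push_cast
      constructor
      · refine le_trans ?_ (h n).1
        calc min (f 0) (c / (2 ^ e * β)) * (((n : ℝ) + 1 + 1) ^ e * β ^ (n + 1))
            ≤ c / (2 ^ e * β) * ((2 * ((n : ℝ) + 1)) ^ e * β ^ (n + 1)) := by
              gcongr
              · exact min_le_right _ _
              · linarith
          _ = c * (((n : ℝ) + 1) ^ e * β ^ n) := by
              rw [mul_pow, pow_succ]; field_simp
      · refine (h n).2.trans ?_
        gcongr
        · exact le_max_right _ _
        · linarith
        · omega

theorem pow {β : ℝ} (hβ : 1 ≤ β) : HasPolyExpGrowth fun n => β ^ n :=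
  ⟨fun n => by positivity, Or.inr ⟨β, 0, 1, 1, hβ, one_pos, one_pos, fun n => by simp⟩⟩

end HasPolyExpGrowth

theorem pow_succ_le_sum_range_succ_pow (e n : ℕ) :
    (n : ℝ) ^ (e + 1) ≤ (e + 1) * ∑ j ∈ Finset.range n, ((j : ℝ) + 1) ^ e := by
  have key : ∀ (x : ℝ), 0 ≤ x → ∀ e : ℕ,
      (x + 1) ^ (e + 1) - x ^ (e + 1) ≤ (e + 1) * (x + 1) ^ e := by
    intro x hx e
    induction e with
    | zero => simp
    | succ e ih =>
      have h1 := mul_le_mul_of_nonneg_left ih (by linarith : (0 : ℝ) ≤ x + 1)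
      have h2 : x ^ (e + 1) ≤ (x + 1) ^ (e + 1) := by gcongr; linarith
      have h3 : (x + 1) ^ (e + 1 + 1) - x ^ (e + 1 + 1)
          = (x + 1) * ((x + 1) ^ (e + 1) - x ^ (e + 1)) + x ^ (e + 1) := by ring
      have h4 : (x + 1) * ((e + 1) * (x + 1) ^ e) = ((e : ℝ) + 1) * (x + 1) ^ (e + 1) := by ring
      push_cast
      linarith
  induction n with
  | zero => simp
  | succ n ih =>
    rw [Finset.sum_range_succ, mul_add]
    push_cast
    linarith [key n n.cast_nonneg e]

/-- Convolving a geometric sequence with a poly-exponential one. -/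
theorem HasPolyExpGrowth.pow_add_sum_polyExp {β γ : ℝ} (hβ : 1 ≤ β) (hγ : 1 ≤ γ) (e : ℕ) :
    HasPolyExpGrowth fun n =>
      β ^ n + ∑ j ∈ Finset.range n, β ^ (n - 1 - j) * (((j : ℝ) + 1) ^ e * γ ^ j) := by
  have hβ0 : 0 < β := by linarith
  have hγ0 : 0 < γ := by linarith
  have hpos : ∀ n : ℕ,
      0 ≤ ∑ j ∈ Finset.range n, β ^ (n - 1 - j) * (((j : ℝ) + 1) ^ e * γ ^ j) :=
    fun n => Finset.sum_nonneg fun j _ => by positivity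
  refine ⟨fun n => add_nonneg (by positivity) (hpos n), Or.inr ?_⟩
  rcases lt_trichotomy γ β with h | rfl | h
  · have hr : 0 < γ / β := by positivity
    have hs := summable_succ_pow_mul_geometric e hr ((div_lt_one hβ0).2 h)
    have hp : ∀ n : ℕ, 0 ≤ ((n : ℝ) + 1) ^ e * (γ / β) ^ n := fun n => by positivity
    have hS : 0 ≤ ∑' n : ℕ, ((n : ℝ) + 1) ^ e * (γ / β) ^ n := tsum_nonneg hp
    refine ⟨β, 0, 1, 1 + ∑' n : ℕ, ((n : ℝ) + 1) ^ e * (γ / β) ^ n, hβ, one_pos, by linarith,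
      fun n => ⟨by simpa using hpos n, ?_⟩⟩
    have h1 : ∑ j ∈ Finset.range n, β ^ (n - 1 - j) * (((j : ℝ) + 1) ^ e * γ ^ j)
        ≤ β ^ n * ∑ j ∈ Finset.range n, ((j : ℝ) + 1) ^ e * (γ / β) ^ j := by
      rw [Finset.mul_sum]
      refine Finset.sum_le_sum fun j hj => ?_
      have hj := Finset.mem_range.1 hj
      calc β ^ (n - 1 - j) * (((j : ℝ) + 1) ^ e * γ ^ j)
          ≤ β ^ (n - j) * (((j : ℝ) + 1) ^ e * γ ^ j) := by
            gcongr
            omega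
        _ = β ^ n * (((j : ℝ) + 1) ^ e * (γ / β) ^ j) := by
            rw [← Nat.sub_add_cancel hj.le, pow_add, div_pow]
            field_simp
            simp
    have h2 := hs.sum_le_tsum (Finset.range n) fun j _ => hp j
    have h3 := mul_le_mul_of_nonneg_left h2 (by positivity : 0 ≤ β ^ n)
    rw [pow_zero, one_mul, add_mul]
    linarith
  · have heq : ∀ n : ℕ, ∑ j ∈ Finset.range n, γ ^ (n - 1 - j) * (((j : ℝ) + 1) ^ e * γ ^ j)
        = γ ^ (n - 1) * ∑ j ∈ Finset.range n, ((j : ℝ) + 1) ^ e := by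
      intro n
      rw [Finset.mul_sum]
      refine Finset.sum_congr rfl fun j hj => ?_
      have hj := Finset.mem_range.1 hj
      have : γ ^ (n - 1) = γ ^ (n - 1 - j) * γ ^ j := by
        rw [← pow_add]; congr 1; omega
      rw [this]; ring
    refine ⟨γ, e + 1, 1 / (2 ^ e * ((e + 1) * γ)), 2, hγ, by positivity, two_pos, fun n => ?_⟩
    have hn : (0 : ℝ) ≤ n := n.cast_nonneg
    simp only [heq]
    constructor
    · have h1 := pow_succ_le_sum_range_succ_pow e n
      have h2 : ((n : ℝ) + 1) ^ (e + 1) ≤ 2 ^ e * ((n : ℝ) ^ (e + 1) + 1) := by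
        simpa using add_pow_le hn zero_le_one (e + 1)
      have h3 : γ ^ n ≤ γ * γ ^ (n - 1) := by
        rw [← pow_succ']
        exact pow_le_pow_right₀ hγ (by omega)
      set S := ∑ j ∈ Finset.range n, ((j : ℝ) + 1) ^ e
      have hS : 0 ≤ S := Finset.sum_nonneg fun j _ => by positivity
      rw [one_div_mul_eq_div, div_le_iff₀ (by positivity)]
      have h4 : (1 : ℝ) ≤ (e + 1) * γ :=
        one_le_mul_of_one_le_of_one_le (by linarith [e.cast_nonneg (α := ℝ)]) hγ
      calc ((n : ℝ) + 1) ^ (e + 1) * γ ^ n ≤ 2 ^ e * ((n : ℝ) ^ (e + 1) + 1) * γ ^ n := by gcongr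
        _ = 2 ^ e * ((n : ℝ) ^ (e + 1) * γ ^ n + 1 * γ ^ n) := by ring
        _ ≤ 2 ^ e * (((e + 1) * S) * (γ * γ ^ (n - 1)) + ((e + 1) * γ) * γ ^ n) := by gcongr
        _ = _ := by ring
    · have h1 : ∑ j ∈ Finset.range n, ((j : ℝ) + 1) ^ e ≤ n * ((n : ℝ) + 1) ^ e := by
        rw [← nsmul_eq_mul]
        simpa using Finset.sum_le_card_nsmul (Finset.range n) (fun j : ℕ => ((j : ℝ) + 1) ^ e)
          (((n : ℝ) + 1) ^ e) fun j hj => by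
            have : (j : ℝ) ≤ n := by exact_mod_cast (Finset.mem_range.1 hj).le
            gcongr
      have h2 : γ ^ (n - 1) ≤ γ ^ n := pow_le_pow_right₀ hγ (by omega)
      have h3 : (1 : ℝ) ≤ ((n : ℝ) + 1) ^ (e + 1) := one_le_pow₀ (by linarith)
      have h4 : n * ((n : ℝ) + 1) ^ e ≤ ((n : ℝ) + 1) ^ (e + 1) := by
        rw [pow_succ']; gcongr; linarith
      have h5 := mul_le_mul h2 (h1.trans h4) (Finset.sum_nonneg fun j _ => by positivity)
        (by positivity)
      have h6 := mul_le_mul_of_nonneg_left h3 (by positivity : 0 ≤ γ ^ n)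
      linarith
  · have hd : 0 < γ - β := by linarith
    refine ⟨γ, e, 1 / (2 ^ e * γ), 1 + 1 / (γ - β), hγ, by positivity, by positivity,
      fun n => ⟨?_, ?_⟩⟩
    · cases n with
      | zero =>
        have : (1 : ℝ) ≤ 2 ^ e * γ :=
          one_le_mul_of_one_le_of_one_le (one_le_pow₀ one_le_two) hγ
        simpa [mul_comm] using inv_le_one_of_one_le₀ this
      | succ n =>
        have hn : (0 : ℝ) ≤ n := n.cast_nonneg
        have h1 : ((n : ℝ) + 1) ^ e * γ ^ n ≤ ∑ j ∈ Finset.range (n + 1),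
            β ^ (n + 1 - 1 - j) * (((j : ℝ) + 1) ^ e * γ ^ j) := by
          rw [Finset.sum_range_succ]
          have : 0 ≤ ∑ j ∈ Finset.range n,
              β ^ (n + 1 - 1 - j) * (((j : ℝ) + 1) ^ e * γ ^ j) :=
            Finset.sum_nonneg fun j _ => by positivity
          simpa using this
        have h2 : 1 / (2 ^ e * γ) * (((n : ℝ) + 1 + 1) ^ e * γ ^ (n + 1))
            ≤ ((n : ℝ) + 1) ^ e * γ ^ n := by
          calc 1 / (2 ^ e * γ) * (((n : ℝ) + 1 + 1) ^ e * γ ^ (n + 1))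
              ≤ 1 / (2 ^ e * γ) * ((2 * ((n : ℝ) + 1)) ^ e * γ ^ (n + 1)) := by
                gcongr; linarith
            _ = ((n : ℝ) + 1) ^ e * γ ^ n := by rw [mul_pow, pow_succ]; field_simp
        have h3 : 0 < β ^ (n + 1) := by positivity
        push_cast
        exact h2.trans (h1.trans (le_add_of_nonneg_left h3.le))
    · have hn : (0 : ℝ) ≤ n := n.cast_nonneg
      have h1 : ∑ j ∈ Finset.range n, β ^ (n - 1 - j) * (((j : ℝ) + 1) ^ e * γ ^ j)
          ≤ ((n : ℝ) + 1) ^ e * ∑ j ∈ Finset.range n, γ ^ j * β ^ (n - 1 - j) := by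
        rw [Finset.mul_sum]
        refine Finset.sum_le_sum fun j hj => ?_
        have : (j : ℝ) ≤ n := by exact_mod_cast (Finset.mem_range.1 hj).le
        calc β ^ (n - 1 - j) * (((j : ℝ) + 1) ^ e * γ ^ j)
            ≤ β ^ (n - 1 - j) * (((n : ℝ) + 1) ^ e * γ ^ j) := by gcongr
          _ = _ := by ring
      have h2 : ∑ j ∈ Finset.range n, γ ^ j * β ^ (n - 1 - j) ≤ γ ^ n / (γ - β) := by
        rw [le_div_iff₀ hd, geom_sum₂_mul]
        linarith [pow_pos hβ0 n]
      have h3 : β ^ n ≤ ((n : ℝ) + 1) ^ e * γ ^ n := by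
        have : (1 : ℝ) ≤ ((n : ℝ) + 1) ^ e := one_le_pow₀ (by linarith)
        calc β ^ n ≤ γ ^ n := by gcongr
          _ ≤ _ := le_mul_of_one_le_left (by positivity) this
      have h4 := mul_le_mul_of_nonneg_left h2 (by positivity : 0 ≤ ((n : ℝ) + 1) ^ e)
      have h5 : (1 + 1 / (γ - β)) * (((n : ℝ) + 1) ^ e * γ ^ n)
          = ((n : ℝ) + 1) ^ e * γ ^ n + ((n : ℝ) + 1) ^ e * (γ ^ n / (γ - β)) := by ring
      rw [h5]
      linarith

theorem HasPolyExpGrowth.pow_add_sum {β : ℝ} (hβ : 1 ≤ β) {h : ℕ → ℝ} (hh : HasPolyExpGrowth h) :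
    HasPolyExpGrowth fun n => β ^ n + ∑ j ∈ Finset.range n, β ^ (n - 1 - j) * h j := by
  have hβ0 : 0 < β := by linarith
  obtain ⟨h0, ⟨N, hN⟩ | ⟨γ, e, c, K, hγ, hc, hK, hb⟩⟩ := hh
  · have hS : 0 ≤ ∑ j ∈ Finset.range N, h j := Finset.sum_nonneg fun j _ => h0 j
    refine (HasPolyExpGrowth.pow hβ).of_comparable one_pos
      (K := 1 + ∑ j ∈ Finset.range N, h j) (by linarith) (fun n => ?_) fun n => ?_
    · have : 0 ≤ ∑ j ∈ Finset.range n, β ^ (n - 1 - j) * h j :=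
        Finset.sum_nonneg fun j _ => mul_nonneg (by positivity) (h0 j)
      linarith
    · have h1 : ∑ j ∈ Finset.range n, β ^ (n - 1 - j) * h j
          ≤ β ^ n * ∑ j ∈ Finset.range n, h j := by
        rw [Finset.mul_sum]
        exact Finset.sum_le_sum fun j _ =>
          mul_le_mul_of_nonneg_right (pow_le_pow_right₀ hβ (by omega)) (h0 j)
      have h2 : ∑ j ∈ Finset.range n, h j ≤ ∑ j ∈ Finset.range N, h j := by
        rcases le_total n N with hle | hle
        · exact Finset.sum_le_sum_of_subset_of_nonneg (Finset.range_mono hle) fun j _ _ => h0 j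
        · rw [← Finset.sum_subset (Finset.range_mono hle)]
          intro j _ hj
          exact hN j (by simpa using hj)
      have h3 := mul_le_mul_of_nonneg_left h2 (by positivity : 0 ≤ β ^ n)
      linarith
  · refine (pow_add_sum_polyExp hβ hγ e).of_comparable (c := min 1 c) (K := max 1 K)
      (by positivity) (by positivity) (fun n => ?_) fun n => ?_
    · rw [mul_add, Finset.mul_sum]
      refine add_le_add (mul_le_of_le_one_left (by positivity) (min_le_left _ _))
        (Finset.sum_le_sum fun j _ => ?_)
      rw [mul_left_comm]
      gcongr
      refine le_trans ?_ (hb j).1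
      gcongr
      exact min_le_right _ _
    · rw [mul_add, Finset.mul_sum]
      refine add_le_add (le_mul_of_one_le_left (by positivity) (le_max_left _ _))
        (Finset.sum_le_sum fun j _ => ?_)
      rw [mul_left_comm (max 1 K)]
      gcongr
      refine (hb j).2.trans ?_
      gcongr
      exact le_max_right _ _

/-- A sequence which is submultiplicative, and supermultiplicative up to a constant, is comparable
to a geometric sequence. -/
theorem exists_geometric_bounds {T : ℕ → ℝ} (h1 : ∀ n, 1 ≤ T n)
    (hsub : ∀ m n, T (m + n) ≤ T m * T n) {K : ℝ} (hK : 0 < K)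
    (hsuper : ∀ m n, T m * T n ≤ K * T (m + n)) :
    ∃ β : ℝ, 1 ≤ β ∧ ∀ n, β ^ n ≤ T n ∧ T n ≤ K * β ^ n := by
  have hT : ∀ n, 0 < T n := fun n => one_pos.trans_le (h1 n)
  have hlog : ∀ n, 0 ≤ Real.log (T n) := fun n => Real.log_nonneg (h1 n)
  have hu : Subadditive fun n => Real.log (T n) := fun m n => by
    rw [← Real.log_mul (hT m).ne' (hT n).ne']
    exact Real.log_le_log (hT _) (hsub m n)
  have hv : Subadditive fun n => Real.log K - Real.log (T n) := fun m n => by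
    have := Real.log_le_log (mul_pos (hT m) (hT n)) (hsuper m n)
    rw [Real.log_mul (hT m).ne' (hT n).ne', Real.log_mul hK.ne' (hT _).ne'] at this
    linarith
  have hbdd : BddBelow (Set.range fun n : ℕ => Real.log (T n) / n) :=
    ⟨0, by rintro _ ⟨n, rfl⟩; exact div_nonneg (hlog n) n.cast_nonneg⟩
  have hlim := hu.tendsto_lim hbdd
  have hlim' : Tendsto (fun n : ℕ => (Real.log K - Real.log (T n)) / n) atTop
      (nhds (-hu.lim)) := by
    simpa only [sub_div, zero_sub] using
      (tendsto_const_div_atTop_nhds_zero_nat (Real.log K)).sub hlim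
  have hbdd' := hlim'.bddBelow_range
  have hL : hv.lim = -hu.lim := tendsto_nhds_unique (hv.tendsto_lim hbdd') hlim'
  have hpow : ∀ n : ℕ, Real.exp hu.lim ^ n = Real.exp (n * hu.lim) := fun n =>
    (Real.exp_nat_mul _ n).symm
  refine ⟨Real.exp hu.lim, Real.one_le_exp (ge_of_tendsto' hlim fun n =>
    div_nonneg (hlog n) n.cast_nonneg), fun n => ?_⟩
  rcases Nat.eq_zero_or_pos n with rfl | hn
  · exact ⟨by simpa using h1 0, by
      simpa using le_of_mul_le_mul_right (hsuper 0 0) (hT _)⟩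
  have hn' : (0 : ℝ) < n := by exact_mod_cast hn
  rw [hpow]
  constructor
  · have := hu.lim_le_div hbdd hn.ne'
    rw [le_div_iff₀ hn'] at this
    rw [← Real.le_log_iff_exp_le (hT n)]
    linarith
  · have := hv.lim_le_div hbdd' hn.ne'
    rw [hL, le_div_iff₀ hn'] at this
    rw [← Real.log_le_log_iff (hT n) (by positivity), Real.log_mul hK.ne' (Real.exp_pos _).ne',
      Real.log_exp]
    linarith

theorem Matrix.sum_mulVec_eq_sum_col_mul {ι : Type*} [Fintype ι] (N : Matrix ι ι ℕ) (v : ι → ℕ) :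
    ∑ i, N.mulVec v i = ∑ x, (∑ i, N i x) * v x := by
  simp only [Matrix.mulVec, dotProduct, Finset.sum_mul]
  exact Finset.sum_comm

section Matrix

variable {ι : Type*} [Fintype ι] [DecidableEq ι]

/-- Sum of all the entries of `N ^ n`. -/
def Matrix.powTotal (N : Matrix ι ι ℕ) (n : ℕ) : ℕ := ∑ i, ∑ j, (N ^ n) i j

theorem Matrix.sum_row_pow_add (N : Matrix ι ι ℕ) (m n : ℕ) (i : ι) :
    ∑ j, (N ^ (m + n)) i j = ∑ x, (N ^ m) i x * ∑ j, (N ^ n) x j := by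
  simp only [pow_add, Matrix.mul_apply, Finset.mul_sum]
  exact Finset.sum_comm

theorem Matrix.sum_row_pow_le_powTotal (N : Matrix ι ι ℕ) (n : ℕ) (i : ι) :
    ∑ j, (N ^ n) i j ≤ N.powTotal n :=
  Finset.single_le_sum (f := fun i => ∑ j, (N ^ n) i j) (fun _ _ => Nat.zero_le _)
    (Finset.mem_univ i)

theorem Matrix.powTotal_transpose (N : Matrix ι ι ℕ) (n : ℕ) :
    N.transpose.powTotal n = N.powTotal n := by
  simp only [powTotal, ← Matrix.transpose_pow, Matrix.transpose_apply]
  exact Finset.sum_comm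

theorem Matrix.sum_row_pow_le_of_pos (N : Matrix ι ι ℕ) {i j : ι} {d : ℕ} (h : 0 < (N ^ d) i j)
    (n : ℕ) : ∑ x, (N ^ n) j x ≤ N.powTotal d * ∑ x, (N ^ n) i x := by
  calc ∑ x, (N ^ n) j x ≤ (N ^ d) i j * ∑ x, (N ^ n) j x := Nat.le_mul_of_pos_left _ h
    _ ≤ ∑ y, (N ^ d) i y * ∑ x, (N ^ n) y x :=
      Finset.single_le_sum (f := fun y => (N ^ d) i y * ∑ x, (N ^ n) y x)
        (fun _ _ => Nat.zero_le _) (Finset.mem_univ j)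
    _ = ∑ y, (N ^ n) i y * ∑ x, (N ^ d) y x := by
      rw [← sum_row_pow_add, ← sum_row_pow_add, add_comm]
    _ ≤ ∑ y, (N ^ n) i y * N.powTotal d :=
      Finset.sum_le_sum fun y _ => Nat.mul_le_mul_left _ (N.sum_row_pow_le_powTotal d y)
    _ = N.powTotal d * ∑ x, (N ^ n) i x := by rw [← Finset.sum_mul, mul_comm]

theorem Matrix.exists_powTotal_le_sum_row (N : Matrix ι ι ℕ)
    (hirr : ∀ i j, ∃ d, 0 < (N ^ d) i j) :
    ∃ K : ℕ, 0 < K ∧ ∀ n i, N.powTotal n ≤ K * ∑ j, (N ^ n) i j := by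
  choose d hd using hirr
  refine ⟨(∑ i, ∑ j, N.powTotal (d i j)) + 1, Nat.succ_pos _, fun n i => ?_⟩
  calc N.powTotal n ≤ ∑ j, N.powTotal (d i j) * ∑ x, (N ^ n) i x :=
        Finset.sum_le_sum fun j _ => N.sum_row_pow_le_of_pos (hd i j) n
    _ = (∑ j, N.powTotal (d i j)) * ∑ x, (N ^ n) i x := by rw [Finset.sum_mul]
    _ ≤ _ := Nat.mul_le_mul_right _ ((Finset.single_le_sum
        (f := fun i => ∑ j, N.powTotal (d i j)) (fun _ _ => Nat.zero_le _)
        (Finset.mem_univ i)).trans (Nat.le_succ _))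

theorem Matrix.powTotal_add (N : Matrix ι ι ℕ) (m n : ℕ) :
    N.powTotal (m + n) = ∑ x, (∑ i, (N ^ m) i x) * ∑ j, (N ^ n) x j := by
  simp only [powTotal, sum_row_pow_add]
  rw [Finset.sum_comm]
  simp only [Finset.sum_mul]

theorem Matrix.powTotal_pos [Nonempty ι] (N : Matrix ι ι ℕ) (hpos : ∀ i, ∃ j, 0 < N i j) (n : ℕ) :
    0 < N.powTotal n := by
  have key : ∀ i, 0 < ∑ j, (N ^ n) i j := by
    induction n with
    | zero => intro i; simp [Matrix.one_apply]
    | succ n ih =>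
      intro i
      obtain ⟨j, hj⟩ := hpos i
      rw [add_comm, sum_row_pow_add, pow_one]
      exact Finset.sum_pos' (fun _ _ => Nat.zero_le _) ⟨j, Finset.mem_univ j, Nat.mul_pos hj (ih j)⟩
  exact Finset.sum_pos (fun i _ => key i) Finset.univ_nonempty

/-- The column sums of powers of an irreducible matrix are comparable to a geometric sequence. -/
theorem Matrix.exists_geometric_bounds_sum_col [Nonempty ι] (N : Matrix ι ι ℕ)
    (hpos : ∀ i, ∃ j, 0 < N i j) (hirr : ∀ i j, ∃ d, 0 < (N ^ d) i j) :
    ∃ β c K : ℝ, 1 ≤ β ∧ 0 < c ∧ 0 < K ∧ ∀ n j,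
      c * β ^ n ≤ ((∑ i, (N ^ n) i j : ℕ) : ℝ) ∧ ((∑ i, (N ^ n) i j : ℕ) : ℝ) ≤ K * β ^ n := by
  obtain ⟨K₂, hK₂, hcol'⟩ := N.transpose.exists_powTotal_le_sum_row fun i j => by
    obtain ⟨d, hd⟩ := hirr j i
    exact ⟨d, by rwa [← Matrix.transpose_pow, Matrix.transpose_apply]⟩
  have hcol : ∀ n j, N.powTotal n ≤ K₂ * ∑ i, (N ^ n) i j := fun n j => by
    simpa only [powTotal_transpose, ← Matrix.transpose_pow, Matrix.transpose_apply]
      using hcol' n j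
  have hcol_le : ∀ n j, ∑ i, (N ^ n) i j ≤ N.powTotal n := fun n j => by
    simpa only [powTotal_transpose, ← Matrix.transpose_pow, Matrix.transpose_apply]
      using N.transpose.sum_row_pow_le_powTotal n j
  have hsub : ∀ m n, N.powTotal (m + n) ≤ N.powTotal m * N.powTotal n := fun m n => by
    rw [powTotal_add]
    calc ∑ x, (∑ i, (N ^ m) i x) * ∑ j, (N ^ n) x j
        ≤ ∑ x, N.powTotal m * ∑ j, (N ^ n) x j :=
          Finset.sum_le_sum fun x _ => Nat.mul_le_mul_right _ (hcol_le m x)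
      _ = N.powTotal m * N.powTotal n := (Finset.mul_sum _ _ _).symm
  have hsuper : ∀ m n, N.powTotal m * N.powTotal n ≤ K₂ * N.powTotal (m + n) := fun m n => by
    rw [powTotal_add]
    calc N.powTotal m * N.powTotal n = ∑ x, N.powTotal m * ∑ j, (N ^ n) x j :=
          Finset.mul_sum _ _ _
      _ ≤ ∑ x, K₂ * (∑ i, (N ^ m) i x) * ∑ j, (N ^ n) x j :=
          Finset.sum_le_sum fun x _ => Nat.mul_le_mul_right _ (hcol m x)
      _ = _ := by rw [Finset.mul_sum]; simp only [mul_assoc]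
  obtain ⟨β, hβ, h⟩ := exists_geometric_bounds (T := fun n => (N.powTotal n : ℝ))
    (fun n => by exact_mod_cast N.powTotal_pos hpos n) (fun m n => by exact_mod_cast hsub m n)
    (K := K₂) (by exact_mod_cast hK₂) fun m n => by exact_mod_cast hsuper m n
  have hK₂' : (0 : ℝ) < K₂ := by exact_mod_cast hK₂
  refine ⟨β, 1 / K₂, K₂, hβ, by positivity, by positivity, fun n j => ⟨?_, ?_⟩⟩
  · rw [one_div_mul_eq_div, div_le_iff₀ hK₂', mul_comm]
    exact (h n).1.trans (by exact_mod_cast hcol n j)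
  · exact le_trans (by exact_mod_cast hcol_le n j) (h n).2

theorem Matrix.linear_recurrence_solution (N : Matrix ι ι ℕ) (u h : ℕ → ι → ℕ)
    (hu : ∀ n, u (n + 1) = N.mulVec (u n) + h n) (n : ℕ) :
    u n = (N ^ n).mulVec (u 0) + ∑ j ∈ Finset.range n, (N ^ (n - 1 - j)).mulVec (h j) := by
  induction n with
  | zero => simp
  | succ n ih =>
    rw [hu, Finset.sum_range_succ, ih, Matrix.mulVec_add, Matrix.mulVec_mulVec, ← pow_succ',
      Matrix.mulVec_sum, add_assoc]
    congr 2
    · refine Finset.sum_congr rfl fun j hj => ?_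
      have hj := Finset.mem_range.1 hj
      rw [Matrix.mulVec_mulVec, ← pow_succ']
      congr 2
      omega
    · simp

theorem Matrix.hasPolyExpGrowth_of_recurrence [Nonempty ι] (N : Matrix ι ι ℕ)
    (hpos : ∀ i, ∃ j, 0 < N i j) (hirr : ∀ i j, ∃ d, 0 < (N ^ d) i j) (u h : ℕ → ι → ℕ)
    (hu0 : ∀ i, u 0 i = 1) (hu : ∀ n, u (n + 1) = N.mulVec (u n) + h n)
    (hh : HasPolyExpGrowth fun n => ((∑ i, h n i : ℕ) : ℝ)) :
    HasPolyExpGrowth fun n => ((∑ i, u n i : ℕ) : ℝ) := by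
  obtain ⟨β, c, K, hβ, hc, hK, hb⟩ := N.exists_geometric_bounds_sum_col hpos hirr
  have hcard : (1 : ℝ) ≤ Fintype.card ι := by exact_mod_cast Fintype.card_pos (α := ι)
  have hsum : ∀ n, ((∑ i, u n i : ℕ) : ℝ) = (∑ x, ((∑ i, (N ^ n) i x : ℕ) : ℝ)) +
      ∑ j ∈ Finset.range n, ∑ x, ((∑ i, (N ^ (n - 1 - j)) i x : ℕ) : ℝ) * h j x := fun n => by
    have : ∑ i, u n i = (∑ x, ∑ i, (N ^ n) i x) +
        ∑ j ∈ Finset.range n, ∑ x, (∑ i, (N ^ (n - 1 - j)) i x) * h j x := by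
      rw [N.linear_recurrence_solution u h hu n]
      simp only [Pi.add_apply, Finset.sum_apply, Finset.sum_add_distrib, sum_mulVec_eq_sum_col_mul,
        hu0, mul_one]
      congr 1
      rw [Finset.sum_comm]
      simp only [sum_mulVec_eq_sum_col_mul]
    rw [this]
    push_cast
    rfl
  refine (HasPolyExpGrowth.pow_add_sum hβ hh).of_comparable hc
    (K := K * Fintype.card ι) (by positivity) (fun n => ?_) fun n => ?_
  · rw [hsum, mul_add, Finset.mul_sum]
    refine add_le_add ?_ (Finset.sum_le_sum fun j _ => ?_)
    · obtain ⟨x⟩ := ‹Nonempty ι›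
      exact (hb n x).1.trans (Finset.single_le_sum
        (f := fun x => ((∑ i, (N ^ n) i x : ℕ) : ℝ)) (fun _ _ => Nat.cast_nonneg _)
        (Finset.mem_univ x))
    · rw [Nat.cast_sum, ← mul_assoc, Finset.mul_sum]
      exact Finset.sum_le_sum fun x _ =>
        mul_le_mul_of_nonneg_right (hb _ x).1 (Nat.cast_nonneg _)
  · rw [hsum, mul_add, Finset.mul_sum]
    refine add_le_add ?_ (Finset.sum_le_sum fun j _ => ?_)
    · calc ∑ x, ((∑ i, (N ^ n) i x : ℕ) : ℝ) ≤ ∑ _x : ι, K * β ^ n :=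
            Finset.sum_le_sum fun x _ => (hb n x).2
        _ = K * Fintype.card ι * β ^ n := by simp; ring
    · calc ∑ x, ((∑ i, (N ^ (n - 1 - j)) i x : ℕ) : ℝ) * h j x
          ≤ ∑ x, K * β ^ (n - 1 - j) * h j x := Finset.sum_le_sum fun x _ =>
            mul_le_mul_of_nonneg_right (hb _ x).2 (Nat.cast_nonneg _)
        _ = K * (β ^ (n - 1 - j) * ((∑ i, h j i : ℕ) : ℝ)) := by
            rw [← Finset.mul_sum, Nat.cast_sum, mul_assoc]
        _ ≤ K * Fintype.card ι * (β ^ (n - 1 - j) * ((∑ i, h j i : ℕ) : ℝ)) := by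
            refine mul_le_mul_of_nonneg_right (le_mul_of_one_le_right hK.le hcard) ?_
            have : 0 ≤ β := by linarith
            positivity

/-- Row sums of the powers of a matrix of natural numbers have poly-exponential growth. -/
theorem Matrix.hasPolyExpGrowth_sum_row_pow (M : Matrix ι ι ℕ) (a : ι) :
    HasPolyExpGrowth fun n => ((∑ b, (M ^ n) a b : ℕ) : ℝ) := by
  classical
  let R : ι → ι → Prop := Relation.ReflTransGen fun x y => 0 < M x y
  have hRpow : ∀ x y, R x y → ∃ d, 0 < (M ^ d) x y := by
    intro x y hxy
    induction hxy using Relation.ReflTransGen.head_induction_on with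
    | refl => exact ⟨0, by simp⟩
    | @head x z hxz _ ih =>
      obtain ⟨d, hd⟩ := ih
      refine ⟨d + 1, ?_⟩
      rw [pow_succ', Matrix.mul_apply]
      exact Finset.sum_pos' (fun _ _ => Nat.zero_le _)
        ⟨z, Finset.mem_univ _, Nat.mul_pos hxz hd⟩
  induction hcard : (Finset.univ.filter (R a)).card using Nat.strong_induction_on generalizing a with
  | _ k ih =>
  have IH : ∀ d, R a d → ¬ R d a → HasPolyExpGrowth fun n => ((∑ b, (M ^ n) d b : ℕ) : ℝ) := by
    intro d had hda
    refine ih _ ?_ d rfl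
    rw [← hcard]
    refine Finset.card_lt_card ⟨fun x hx => ?_, fun hsub => hda ?_⟩
    · simp only [Finset.mem_filter, Finset.mem_univ, true_and] at hx ⊢
      exact had.trans hx
    · have := hsub (Finset.mem_filter.2 ⟨Finset.mem_univ a, Relation.ReflTransGen.refl⟩)
      exact (Finset.mem_filter.1 this).2
  by_cases hcyc : Relation.TransGen (fun x y => 0 < M x y) a a
  · let C : ι → Prop := fun x => R a x ∧ R x a
    let N : Matrix {x // C x} {x // C x} ℕ := fun x y => M x y
    have hCa : C a := ⟨.refl, .refl⟩
    have : Nonempty {x // C x} := ⟨⟨a, hCa⟩⟩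
    have hpos : ∀ i, ∃ j, 0 < N i j := by
      rintro ⟨i, hai, hia⟩
      obtain ⟨y, hiy, hya⟩ := Relation.TransGen.head'_iff.1 (Relation.TransGen.trans_right hia hcyc)
      exact ⟨⟨y, hai.tail hiy, hya⟩, hiy⟩
    have hirr : ∀ i j, ∃ d, 0 < (N ^ d) i j := by
      rintro ⟨i, hi⟩ ⟨j, hj⟩
      have hij : R i j := hi.2.trans hj.1
      induction hij using Relation.ReflTransGen.head_induction_on with
      | refl => exact ⟨0, by simp⟩
      | @head x y hxy hyj ihy =>
        have hy : C y := ⟨hi.1.tail hxy, Relation.ReflTransGen.trans hyj hj.2⟩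
        obtain ⟨d, hd⟩ := ihy hy
        refine ⟨d + 1, ?_⟩
        rw [pow_succ', Matrix.mul_apply]
        exact Finset.sum_pos' (fun _ _ => Nat.zero_le _)
          ⟨⟨y, hy⟩, Finset.mem_univ _, Nat.mul_pos hxy hd⟩
    have hU := N.hasPolyExpGrowth_of_recurrence hpos hirr (fun n c => ∑ b, (M ^ n) c b)
      (fun n c => ∑ d : {x // ¬ C x}, M c d * ∑ b, (M ^ n) d b)
      (fun c => by simp [Matrix.one_apply])
      (fun n => by
        ext c
        simp only [Pi.add_apply, Matrix.mulVec, dotProduct]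
        rw [add_comm n 1, M.sum_row_pow_add 1 n, pow_one]
        exact (Fintype.sum_subtype_add_sum_subtype C
          fun x => M c x * ∑ b, (M ^ n) x b).symm)
      (by
        simp only [Nat.cast_sum (R := ℝ) (Finset.univ : Finset {x // C x}),
          Nat.cast_sum (R := ℝ) (Finset.univ : Finset {x // ¬ C x}), Nat.cast_mul (α := ℝ)]
        refine .sum _ fun c _ => .sum _ fun d _ => ?_
        rcases Nat.eq_zero_or_pos (M c d) with h0 | h0
        · simpa [h0] using HasPolyExpGrowth.zero
        · have had : R a d := c.2.1.tail h0
          exact (IH d had fun hda => d.2 ⟨had, hda⟩).const_mul (by exact_mod_cast h0))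
    choose d hd using fun c : {x // C x} => hRpow a c c.2.1
    let K : ℕ := (∑ c, M.powTotal (d c)) + 1
    have hK : (0 : ℝ) < K := by exact_mod_cast Nat.succ_pos _
    refine hU.of_comparable (c := 1 / K) (K := 1) (by positivity) one_pos (fun n => ?_) fun n => ?_
    · rw [one_div_mul_eq_div, div_le_iff₀ hK]
      have : ∑ c : {x // C x}, ∑ b, (M ^ n) c b ≤ (∑ b, (M ^ n) a b) * K := by
        calc ∑ c : {x // C x}, ∑ b, (M ^ n) c b
            ≤ ∑ c, M.powTotal (d c) * ∑ b, (M ^ n) a b :=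
              Finset.sum_le_sum fun c _ => M.sum_row_pow_le_of_pos (hd c) n
          _ = (∑ b, (M ^ n) a b) * ∑ c, M.powTotal (d c) := by rw [← Finset.sum_mul, mul_comm]
          _ ≤ _ := Nat.mul_le_mul_left _ (Nat.le_succ _)
      exact_mod_cast this
    · rw [one_mul]
      exact_mod_cast Finset.single_le_sum (f := fun c : {x // C x} => ∑ b, (M ^ n) c b)
        (fun _ _ => Nat.zero_le _) (Finset.mem_univ ⟨a, hCa⟩)
  · refine HasPolyExpGrowth.of_succ (by simp [Matrix.one_apply]) ?_
    simp only [add_comm _ 1, M.sum_row_pow_add 1, pow_one]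
    simp only [Nat.cast_sum (R := ℝ) Finset.univ (fun x => M a x * _), Nat.cast_mul (α := ℝ)]
    refine .sum _ fun d _ => ?_
    rcases Nat.eq_zero_or_pos (M a d) with h0 | h0
    · simpa [h0] using HasPolyExpGrowth.zero
    · exact (IH d (.single h0) fun hda => hcyc (.head' h0 hda)).const_mul (by exact_mod_cast h0)

end Matrix

theorem wordMap_iterate_append (φ : A → List A) (n : ℕ) (v w : List A) :
    (wordMap φ)^[n] (v ++ w) = (wordMap φ)^[n] v ++ (wordMap φ)^[n] w := by
  induction n generalizing v w with
  | zero => rfl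
  | succ n ih => simp only [Function.iterate_succ_apply, wordMap, List.flatMap_append, ih]

theorem length_wordMap_iterate (φ : A → List A) (n : ℕ) (w : List A) :
    ((wordMap φ)^[n] w).length = (w.map fun b => ((wordMap φ)^[n] [b]).length).sum := by
  induction w with
  | nil =>
    have : (wordMap φ)^[n] [] = [] := Function.iterate_fixed rfl n
    simp [this]
  | cons b w ih =>
    rw [← List.singleton_append, wordMap_iterate_append, List.length_append, ih]
    simp

theorem length_wordMap_iterate_eq_sum_pow [Fintype A] [DecidableEq A] (φ : A → List A) (n : ℕ)
    (a : A) : ((wordMap φ)^[n] [a]).length =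
      ∑ b, ((Matrix.of fun x y => (φ x).count y : Matrix A A ℕ) ^ n) a b := by
  induction n generalizing a with
  | zero => simp [Matrix.one_apply]
  | succ n ih =>
    rw [add_comm n 1, Matrix.sum_row_pow_add, pow_one, add_comm 1 n, Function.iterate_succ_apply]
    have : wordMap φ [a] = φ a := by simp [wordMap]
    rw [this, length_wordMap_iterate, Finset.sum_list_map_count]
    simp only [← ih, Matrix.of_apply, smul_eq_mul]
    refine Finset.sum_subset (Finset.subset_univ _) fun x _ hx => ?_
    rw [List.count_eq_zero_of_not_mem (by simpa using hx), zero_mul]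

theorem HasPolyExpGrowth.exists_isTheta {f : ℕ → ℝ} (hf : HasPolyExpGrowth f) :
    ∃ (β : ℝ) (e : ℕ), (1 ≤ β ∨ (β = 0 ∧ e = 0)) ∧
      f =Θ[atTop] fun k : ℕ => (k : ℝ) ^ e * β ^ k := by
  obtain ⟨h0, ⟨N, hN⟩ | ⟨β, e, c, K, hβ, hc, hK, h⟩⟩ := hf
  · refine ⟨0, 0, Or.inr ⟨rfl, rfl⟩, Filter.EventuallyEq.isTheta ?_⟩
    filter_upwards [eventually_ge_atTop (max N 1)] with n hn
    rw [hN n (le_trans (le_max_left _ _) hn)]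
    have : n ≠ 0 := by have := le_trans (le_max_right N 1) hn; omega
    simp [this]
  · have hβ0 : 0 < β := by linarith
    refine ⟨β, e, Or.inl hβ, ?_, ?_⟩
    · refine IsBigO.of_bound (K * 2 ^ e) ?_
      filter_upwards [eventually_ge_atTop 1] with n hn
      have hn' : (1 : ℝ) ≤ n := by exact_mod_cast hn
      rw [Real.norm_of_nonneg (h0 n), Real.norm_of_nonneg (by positivity)]
      calc f n ≤ K * (((n : ℝ) + 1) ^ e * β ^ n) := (h n).2
        _ ≤ K * ((2 * (n : ℝ)) ^ e * β ^ n) := by gcongr; linarith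
        _ = _ := by rw [mul_pow]; ring
    · refine IsBigO.of_bound (1 / c) (Eventually.of_forall fun n => ?_)
      rw [Real.norm_of_nonneg (h0 n), Real.norm_of_nonneg (by positivity), one_div_mul_eq_div,
        le_div_iff₀ hc, mul_comm]
      refine le_trans ?_ (h n).1
      gcongr
      linarith

/-- Salomaa–Soittola: growth rate of a letter under a morphism. -/
theorem salomaa_soittola {A : Type*} [Fintype A] (φ : A → List A) (a : A) :
    ∃ (β : ℝ) (e : ℕ), (1 ≤ β ∨ (β = 0 ∧ e = 0)) ∧
      (fun k => (((wordMap φ)^[k] [a]).length : ℝ)) =Θ[atTop]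
        (fun k => (k : ℝ) ^ e * β ^ k) := by
  classical
  simp only [length_wordMap_iterate_eq_sum_pow]
  exact (Matrix.hasPolyExpGrowth_sum_row_pow _ a).exists_isTheta
end
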